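/- arXiv:1002.3630 — 2 statements merged into one kernel-verified Lean document; each statement's English description precedes it below -/
import Mathlib

section
/- Let n ≥ 2 and consider the action of K = U(2) × SU(n) on M_{2×n}(ℂ) × 𝔲(2) given by (k₁,k₂)·(v,z) = (k₁ v k₂*, k₁ z k₁*), where 𝔲(2) is the space of complex skew-Hermitian 2×2 matrices. Then every real-valued polynomial function P on M_{2×n}(ℂ) × 𝔲(2) (polynomial in the real coordinates) invariant under this action belongs to the ℝ-subalgebra generated by the five real-valued functions F₁(v,z) = i tr(z), F₂(v,z) = tr(z²), F₃(v,z) = tr(v v*), F₄(v,z) = tr((v v*)²), F₅(v,z) = i tr(v* z v). -/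
open MvPolynomial in
theorem MvPolynomial.exists_eval_comp_eq {A σ τ R : Type*} [CommRing R]
    (f : A → σ → R) (x : A → τ → R)
    (h : ∀ i, ∃ q : MvPolynomial τ R, ∀ a, f a i = eval (x a) q) (p : MvPolynomial σ R) :
    ∃ g : MvPolynomial τ R, ∀ a, eval (f a) p = eval (x a) g := by
  choose q hq using h
  refine ⟨bind₁ q p, fun a => ?_⟩
  have hf : f a = fun i => eval (x a) (q i) := by
    funext i
    exact hq i a
  rw [hf, eval, eval, eval₂Hom_bind₁]

open MvPolynomial in
theorem MvPolynomial.exists_eval_substSq {σ R : Type*} [CommRing R] [DecidableEq σ] (i : σ)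
    (p : MvPolynomial σ R) :
    ∃ g : MvPolynomial σ R, ∀ x, eval (Function.update x i (x i ^ 2)) p = eval x g := by
  refine exists_eval_comp_eq (fun x : σ → R => Function.update x i (x i ^ 2)) id (fun j => ?_) p
  rcases eq_or_ne j i with rfl | hj
  · exact ⟨X j ^ 2, by simp⟩
  · exact ⟨X j, by simp [hj]⟩

open MvPolynomial in
theorem MvPolynomial.exists_even_odd_parts {σ R : Type*} [CommRing R] [DecidableEq σ] (i : σ)
    (p : MvPolynomial σ R) :
    ∃ g h : MvPolynomial σ R, ∀ x : σ → R,
      eval x p = eval (Function.update x i (x i ^ 2)) g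
        + x i * eval (Function.update x i (x i ^ 2)) h := by
  induction p using MvPolynomial.induction_on with
  | C a => exact ⟨C a, 0, fun x => by simp⟩
  | add p q hp hq =>
    obtain ⟨g, h, hp⟩ := hp
    obtain ⟨g', h', hq⟩ := hq
    exact ⟨g + g', h + h', fun x => by simp only [map_add, hp, hq]; ring⟩
  | mul_X p j hp =>
    obtain ⟨g, h, hp⟩ := hp
    rcases eq_or_ne j i with rfl | hj
    · exact ⟨X j * h, g, fun x => by
        simp only [map_mul, eval_X, hp, Function.update_self]; ring⟩
    · exact ⟨g * X j, h * X j, fun x => by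
        simp only [map_mul, eval_X, hp, Function.update_of_ne hj]; ring⟩

open MvPolynomial in
/-- A function that is even in the `i`-th coordinate along a family of points and polynomial there
is a polynomial in the square of that coordinate. -/
theorem MvPolynomial.exists_eval_sq_of_even {σ : Type*} [DecidableEq σ] (i : σ)
    (p : MvPolynomial σ ℝ) :
    ∃ g : MvPolynomial σ ℝ, ∀ x : σ → ℝ,
      eval (Function.update x i (-x i)) p = eval x p →
        eval x p = eval (Function.update x i (x i ^ 2)) g := by
  obtain ⟨g, h, hp⟩ := exists_even_odd_parts i p
  refine ⟨g, fun x hx => ?_⟩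
  have h2 := hp (Function.update x i (-x i))
  simp only [Function.update_self, Function.update_idem, neg_sq] at h2
  rw [h2] at hx
  have h1 := hp x
  linarith

open MvPolynomial in
theorem MvPolynomial.exists_clear_denominators {σ τ R : Type*} [CommRing R]
    (H : MvPolynomial τ R) (u : σ → MvPolynomial τ R) (p : MvPolynomial σ R) :
    ∃ (k : ℕ) (q : MvPolynomial τ R), ∀ (x : τ → R) (y : σ → R),
      (∀ i, eval x H * y i = eval x (u i)) → eval x H ^ k * eval y p = eval x q := by
  induction p using MvPolynomial.induction_on with
  | C a => exact ⟨0, C a, fun x y _ => by simp⟩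
  | add p q hp hq =>
    obtain ⟨k, p', hp⟩ := hp
    obtain ⟨l, q', hq⟩ := hq
    refine ⟨k + l, H ^ l * p' + H ^ k * q', fun x y h => ?_⟩
    simp only [map_add, map_mul, map_pow, ← hp x y h, ← hq x y h]
    ring
  | mul_X p j hp =>
    obtain ⟨k, p', hp⟩ := hp
    refine ⟨k + 1, p' * u j, fun x y h => ?_⟩
    simp only [map_mul, eval_X, ← hp x y h, ← h j]
    ring

open MvPolynomial in
theorem MvPolynomial.prime_X_of_isDomain {σ R : Type*} [CommRing R] [IsDomain R] (i : σ) :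
    Prime (X i : MvPolynomial σ R) :=
  ⟨X_ne_zero i, fun h => by
    have := h.map (eval (0 : σ → R))
    simp at this, fun _ _ h => X_dvd_mul_iff.1 h⟩

open MvPolynomial in
theorem MvPolynomial.exists_eval_neg {σ R : Type*} [CommRing R] [DecidableEq σ] (i : σ)
    (p : MvPolynomial σ R) :
    ∃ g : MvPolynomial σ R, ∀ x, eval (Function.update x i (-x i)) p = eval x g := by
  refine exists_eval_comp_eq (fun x : σ → R => Function.update x i (-x i)) id (fun j => ?_) p
  rcases eq_or_ne j i with rfl | hj
  · exact ⟨-X j, by simp⟩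
  · exact ⟨X j, by simp [hj]⟩

open MvPolynomial in
/-- If `h * q` is even in the `i`-th variable, where `h ≠ 0` is even, then `q` is even. -/
theorem MvPolynomial.eval_neg_eq_of_mul {σ : Type*} [DecidableEq σ] (i : σ)
    {h q : MvPolynomial σ ℝ} (h0 : h ≠ 0)
    (hh : ∀ x, eval (Function.update x i (-x i)) h = eval x h)
    (hq : ∀ x, eval (Function.update x i (-x i)) (h * q) = eval x (h * q)) (x : σ → ℝ) :
    eval (Function.update x i (-x i)) q = eval x q := by
  obtain ⟨g, hg⟩ := exists_eval_neg i q
  rw [hg]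
  congr 1
  refine mul_left_cancel₀ h0 (MvPolynomial.funext fun y => ?_)
  rw [← hq y, map_mul, map_mul, ← hg, hh]

open MvPolynomial in
theorem polynomial_descent (g₁ g₂ : MvPolynomial (Fin 5) ℝ)
    (h : ∀ p m d r e : ℝ, 0 < d → d < p → 0 < e → |m| < d * e →
      eval ![(p + d) / 2, (p - d) / 2, (e ^ 2 - (m / d) ^ 2) / 4, (r + m / d) / 2, (r - m / d) / 2]
        g₁ =
      eval ![(p + m / e) / 2, (p - m / e) / 2 - (d ^ 2 - (m / e) ^ 2) / (2 * (p + m / e)),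
        (d ^ 2 - (m / e) ^ 2) / (2 * (p + m / e)), (r + e) / 2, (r - e) / 2] g₂) :
    ∃ Q : MvPolynomial (Fin 5) ℝ, ∀ α β c s t : ℝ,
      eval ![α, β, c ^ 2, s, t] g₁ =
        eval ![α + β, (α - β) * (s - t), (α - β) ^ 2, s + t, (s - t) ^ 2 + 4 * c ^ 2] Q := by
  obtain ⟨K, G₁, hG₁⟩ := exists_clear_denominators (X 2 ^ 2 : MvPolynomial (Fin 5) ℝ)
    ![C (1 / 2) * X 2 ^ 2 * (X 0 + X 2), C (1 / 2) * X 2 ^ 2 * (X 0 - X 2),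
      C (1 / 4) * (X 2 ^ 2 * X 4 - X 1 ^ 2), C (1 / 2) * X 2 * (X 2 * X 3 + X 1),
      C (1 / 2) * X 2 * (X 2 * X 3 - X 1)] g₁
  set H : MvPolynomial (Fin 5) ℝ := C 2 * X 4 * (X 0 * X 4 + X 1) with hH
  obtain ⟨L, G₂, hG₂⟩ := exists_clear_denominators H
    ![(X 0 * X 4 + X 1) ^ 2, X 4 ^ 2 * (X 0 ^ 2 - X 2), X 2 * X 4 ^ 2 - X 1 ^ 2,
      C (1 / 2) * H * (X 3 + X 4), C (1 / 2) * H * (X 3 - X 4)] g₂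
  obtain ⟨G₁', hG₁'⟩ := exists_eval_substSq 4 G₁
  obtain ⟨G₂', hG₂'⟩ := exists_eval_substSq 2 G₂
  have hG₁x : ∀ p m d r e : ℝ, d ≠ 0 → (d ^ 2) ^ K *
      eval ![(p + d) / 2, (p - d) / 2, (e ^ 2 - (m / d) ^ 2) / 4, (r + m / d) / 2, (r - m / d) / 2]
        g₁ = eval ![p, m, d, r, e] G₁' := by
    intro p m d r e hd
    rw [← hG₁', ← hG₁ _ ![(p + d) / 2, (p - d) / 2, (e ^ 2 - (m / d) ^ 2) / 4,
      (r + m / d) / 2, (r - m / d) / 2]]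
    · simp
    · intro i
      fin_cases i <;> simp <;> field_simp
  have key : H ^ L * G₁' = X 2 ^ (2 * K) * G₂' := by
    refine funext_set ![Set.Ioo 2 3, Set.Ioo 0 1, Set.Ioo 1 2, Set.univ, Set.Ioo 1 2] ?_ ?_
    · intro i
      fin_cases i
      · exact Set.Ioo_infinite (by norm_num)
      · exact Set.Ioo_infinite (by norm_num)
      · exact Set.Ioo_infinite (by norm_num)
      · exact Set.infinite_univ
      · exact Set.Ioo_infinite (by norm_num)
    · intro x hx
      have h0 := hx 0 trivial
      have h1 := hx 1 trivial
      have h2 := hx 2 trivial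
      have h4 := hx 4 trivial
      obtain ⟨p, m, d, r, e, rfl⟩ : ∃ p m d r e, x = ![p, m, d, r, e] :=
        ⟨x 0, x 1, x 2, x 3, x 4, by ext i; fin_cases i <;> rfl⟩
      simp only [Matrix.cons_val, Set.mem_Ioo] at h0 h1 h2 h4
      have hd : 0 < d := by linarith
      have he : 0 < e := by linarith
      have hm : 0 < p * e + m := by nlinarith
      have hm₁ : p * e + m ≠ 0 := hm.ne'
      have hm₂ : e * p + m ≠ 0 := by rwa [mul_comm e p]
      have hm' : p + m / e ≠ 0 := by
        have : 0 < m / e := div_pos h1.1 he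
        linarith
      rw [map_mul, map_mul, ← hG₁x _ _ _ _ _ hd.ne', h p m d r e hd (by linarith) he
        (by rw [abs_of_pos h1.1]; nlinarith), ← hG₂']
      have hH' : ∀ D : ℝ, eval ![p, m, D, r, e] H = 2 * e * (p * e + m) := by
        intro D; simp [hH]
      have hu : Function.update ![p, m, d, r, e] 2 (![p, m, d, r, e] 2 ^ 2)
          = ![p, m, d ^ 2, r, e] := by
        ext i; fin_cases i <;> rfl
      rw [hu, ← hG₂ _ ![(p + m / e) / 2,
        (p - m / e) / 2 - (d ^ 2 - (m / e) ^ 2) / (2 * (p + m / e)),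
        (d ^ 2 - (m / e) ^ 2) / (2 * (p + m / e)), (r + e) / 2, (r - e) / 2]]
      · simp [hH']
        ring
      · have h3 : p + m / e = (p * e + m) / e := by field_simp
        intro i
        rw [hH', h3]
        fin_cases i <;> simp [hH']
        all_goals field_simp
        all_goals ring
  have hH0 : H ≠ 0 := by
    intro h0
    have := congrArg (eval ![1, 0, 0, 0, 1]) h0
    simp [hH] at this
  have hX : ¬ (X 2 : MvPolynomial (Fin 5) ℝ) ∣ H ^ L := by
    intro hdvd
    obtain ⟨q, hq⟩ := (prime_X_of_isDomain 2).dvd_of_dvd_pow hdvd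
    have := congrArg (eval ![1, 0, 0, 0, 1]) hq
    simp [hH] at this
  obtain ⟨Q, rfl⟩ : X 2 ^ (2 * K) ∣ G₁' :=
    (prime_X_of_isDomain 2).pow_dvd_of_dvd_mul_left _ hX ⟨_, key⟩
  have hQ : H ^ L * Q = G₂' := by
    refine mul_left_cancel₀ (pow_ne_zero (2 * K) (X_ne_zero (R := ℝ) (2 : Fin 5))) ?_
    rw [← key]
    ring
  obtain ⟨Q₁, hQ₁⟩ := exists_eval_sq_of_even 4 Q
  obtain ⟨Q₂, hQ₂⟩ := exists_eval_sq_of_even 2 Q₁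
  have even4 := eval_neg_eq_of_mul 4 (pow_ne_zero (2 * K) (X_ne_zero (R := ℝ) (2 : Fin 5)))
    (by simp) (q := Q) (fun x => by
      rw [← hG₁', ← hG₁']
      simp)
  have even2 := eval_neg_eq_of_mul 2 (pow_ne_zero L hH0) (by simp [hH]) (q := Q) (fun x => by
      rw [hQ, ← hG₂', ← hG₂']
      simp)
  have hQx : ∀ p m d r e : ℝ, eval ![p, m, d, r, e] Q = eval ![p, m, d ^ 2, r, e ^ 2] Q₂ := by
    intro p m d r e
    have u4 : ∀ d e x : ℝ, Function.update ![p, m, d, r, e] 4 x = ![p, m, d, r, x] := by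
      intro d e x; ext i; fin_cases i <;> rfl
    have u2 : ∀ d e x : ℝ, Function.update ![p, m, d, r, e] 2 x = ![p, m, x, r, e] := by
      intro d e x; ext i; fin_cases i <;> rfl
    have a : ∀ d, eval ![p, m, d, r, e] Q = eval ![p, m, d, r, e ^ 2] Q₁ := by
      intro d
      rw [hQ₁ _ (even4 _), u4]; rfl
    have b := hQ₂ ![p, m, d, r, e ^ 2] (by
      have := even2 ![p, m, d, r, e]
      rw [u2] at this ⊢
      rw [← a, ← a]
      exact this)
    rw [u2] at b
    rw [a, b]; rfl
  refine ⟨Q₂, fun α β c s t => ?_⟩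
  have hne : ∀ α, α ≠ β → eval ![α, β, c ^ 2, s, t] g₁ =
        eval ![α + β, (α - β) * (s - t), (α - β) ^ 2, s + t, (s - t) ^ 2 + 4 * c ^ 2] Q₂ := by
    intro α hα
    have hd : α - β ≠ 0 := sub_ne_zero.2 hα
    have hs := Real.sq_sqrt (show 0 ≤ (s - t) ^ 2 + 4 * c ^ 2 by positivity)
    have e1 := hG₁x (α + β) ((α - β) * (s - t)) (α - β) (s + t) (√((s - t) ^ 2 + 4 * c ^ 2)) hd
    rw [map_mul, hQx, hs, mul_div_cancel_left₀ _ hd] at e1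
    have e2 := mul_left_cancel₀ (pow_ne_zero K (pow_ne_zero 2 hd))
      (e1.trans (by simp [pow_mul] :
        _ = ((α - β) ^ 2) ^ K * eval ![α + β, (α - β) * (s - t), (α - β) ^ 2, s + t,
          (s - t) ^ 2 + 4 * c ^ 2] Q₂))
    rw [← e2]
    congr 2
    ext i
    fin_cases i <;> simp
  have hc : ∀ (q : MvPolynomial (Fin 5) ℝ) (f : ℝ → Fin 5 → ℝ), Continuous f →
      Continuous fun x => eval (f x) q := fun q f hf => (MvPolynomial.continuous_eval q).comp hf
  have := Continuous.ext_on (dense_compl_singleton β)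
    (hc g₁ (fun α => ![α, β, c ^ 2, s, t]) (by
      refine continuous_pi fun i => ?_
      fin_cases i <;> simp <;> fun_prop))
    (hc Q₂ (fun α => ![α + β, (α - β) * (s - t), (α - β) ^ 2, s + t, (s - t) ^ 2 + 4 * c ^ 2]) (by
      refine continuous_pi fun i => ?_
      fin_cases i <;> simp <;> fun_prop)) (fun α hα => hne α hα)
  exact congrFun this α

theorem LinearIsometry.exists_apply_eq_of_norm_eq {𝕜 V W : Type*} [RCLike 𝕜]
    [NormedAddCommGroup V] [InnerProductSpace 𝕜 V] [FiniteDimensional 𝕜 V]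
    [AddCommGroup W] [Module 𝕜 W] (f g : W →ₗ[𝕜] V) (h : ∀ x, ‖f x‖ = ‖g x‖) :
    ∃ L : V →ₗᵢ[𝕜] V, ∀ x, L (f x) = g x := by
  obtain ⟨s, hs⟩ := f.rangeRestrict.exists_rightInverse_of_surjective f.range_rangeRestrict
  have hs' : ∀ y, f (s y) = y := fun y => congrArg Subtype.val (LinearMap.congr_fun hs y)
  let L₀ : LinearMap.range f →ₗᵢ[𝕜] V :=
    ⟨g ∘ₗ s, fun y => by
      rw [LinearMap.comp_apply, ← h, hs', Submodule.coe_norm]⟩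
  refine ⟨L₀.extend, fun x => ?_⟩
  have e := L₀.extend_apply ⟨f x, x, rfl⟩
  rw [e, ← sub_eq_zero, ← norm_eq_zero]
  change ‖g (s ⟨f x, x, rfl⟩) - g x‖ = 0
  rw [← map_sub, ← h, map_sub, hs', sub_self, norm_zero]

open Matrix in
theorem Matrix.exists_unitary_mul_of_mul_conjTranspose_eq {m n : Type*} [Fintype m] [Fintype n]
    [DecidableEq m] [DecidableEq n] (v w : Matrix m n ℂ) (h : v * vᴴ = w * wᴴ) :
    ∃ U : Matrix n n ℂ, U * Uᴴ = 1 ∧ w = v * Uᴴ := by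
  have hnorm : ∀ (v : Matrix m n ℂ) (x : EuclideanSpace ℂ m), ‖toEuclideanLin vᴴ x‖ ^ 2 =
      RCLike.re (inner ℂ x (toEuclideanLin (v * vᴴ) x)) := by
    intro v x
    rw [@norm_sq_eq_re_inner ℂ, ← LinearMap.adjoint_inner_right,
      ← toEuclideanLin_conjTranspose_eq_adjoint, conjTranspose_conjTranspose]
    simp [toLpLin_apply, mulVec_mulVec]
  obtain ⟨L, hL⟩ := LinearIsometry.exists_apply_eq_of_norm_eq (toEuclideanLin vᴴ)
    (toEuclideanLin wᴴ) (fun x => by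
      rw [← sq_eq_sq₀ (norm_nonneg _) (norm_nonneg _), hnorm, hnorm, h])
  have hU : toEuclideanLin (toEuclideanLin.symm L.toLinearMap) = L.toLinearMap :=
    LinearEquiv.apply_symm_apply _ _
  set U := toEuclideanLin.symm L.toLinearMap
  refine ⟨U, mul_eq_one_comm.1 (toEuclideanLin.injective (LinearMap.ext fun x => ?_)), ?_⟩
  · refine ext_inner_left ℂ fun y => ?_
    have := L.inner_map_map y x
    rw [← L.coe_toLinearMap, ← hU, ← LinearMap.adjoint_inner_right,
      ← toEuclideanLin_conjTranspose_eq_adjoint] at this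
    simpa [toLpLin_apply, mulVec_mulVec] using this
  · rw [← conjTranspose_conjTranspose w, ← conjTranspose_conjTranspose v, ← conjTranspose_mul]
    refine congrArg conjTranspose (toEuclideanLin.injective (LinearMap.ext fun x => ?_))
    have := hL x
    rw [← L.coe_toLinearMap, ← hU] at this
    rw [← this]
    simp [toLpLin_apply, mulVec_mulVec]

open Matrix in
/-- A function invariant under `U(m) × SU(n)` only depends on `v` through the matrix `v vᴴ`, up to
simultaneous unitary conjugation. -/
theorem eq_of_unitary_conj_gram {m n : Type*} [Fintype m] [Fintype n]
    [DecidableEq m] [DecidableEq n] [Nonempty n]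
    (F : Matrix m n ℂ → Matrix m m ℂ → ℝ)
    (hinv : ∀ (k₁ : Matrix m m ℂ) (k₂ : Matrix n n ℂ),
      k₁ * k₁.conjTranspose = 1 → k₂ * k₂.conjTranspose = 1 → k₂.det = 1 →
      ∀ (v : Matrix m n ℂ) (z : Matrix m m ℂ), z.conjTranspose = -z →
        F (k₁ * v * k₂.conjTranspose) (k₁ * z * k₁.conjTranspose) = F v z)
    (k : Matrix m m ℂ) (hk : k * kᴴ = 1) (v w : Matrix m n ℂ) (z z' : Matrix m m ℂ)
    (hz : zᴴ = -z) (hv : k * (v * vᴴ) * kᴴ = w * wᴴ) (hz' : k * z * kᴴ = z') :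
    F w z' = F v z := by
  obtain ⟨U, hU, rfl⟩ := exists_unitary_mul_of_mul_conjTranspose_eq (k * v) w
    (by rw [← hv, conjTranspose_mul]; simp only [Matrix.mul_assoc])
  subst hz'
  have hdet : U.det * star U.det = 1 := by
    rw [← det_conjTranspose, ← det_mul, hU, det_one]
  obtain ⟨μ, hμ⟩ := IsAlgClosed.exists_pow_nat_eq (star U.det)
    (Fintype.card_pos (α := n))
  have hμ1 : μ * star μ = 1 := by
    have h1 : ‖U.det‖ = 1 := by
      have := congrArg norm hdet
      rw [norm_mul, norm_star, norm_one] at this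
      nlinarith [norm_nonneg U.det]
    have h2 : ‖μ‖ = 1 := by
      rw [← pow_eq_one_iff_of_nonneg (norm_nonneg μ) (Fintype.card_ne_zero (α := n)),
        ← norm_pow, hμ, norm_star, h1]
    have := Complex.mul_conj μ
    rw [Complex.normSq_eq_norm_sq, h2] at this
    simpa using this
  have hμ2 : starRingEnd ℂ μ * μ = 1 := by rw [mul_comm]; exact hμ1
  have := hinv (μ • k) (μ • U)
    (by rw [conjTranspose_smul, smul_mul_smul_comm, hμ1, hk, one_smul])
    (by rw [conjTranspose_smul, smul_mul_smul_comm, hμ1, hU, one_smul])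
    (by rw [det_smul, hμ, mul_comm, hdet]) v z hz
  rw [← this]
  simp [conjTranspose_smul, smul_smul, hμ2]

open Matrix ComplexOrder in
theorem Matrix.exists_unitary_conj_diagonal_and_skew {n : Type*} [Fintype n]
    (v : Matrix (Fin 2) n ℂ) (z : Matrix (Fin 2) (Fin 2) ℂ) (hz : zᴴ = -z) :
    ∃ (k : Matrix (Fin 2) (Fin 2) ℂ) (a b c s t : ℝ), k * kᴴ = 1 ∧
      k * (v * vᴴ) * kᴴ = !![(a ^ 2 : ℂ), 0; 0, (b ^ 2 : ℂ)] ∧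
      k * z * kᴴ = !![Complex.I * s, Complex.I * c; Complex.I * c, Complex.I * t] := by
  have hh := posSemidef_self_mul_conjTranspose v
  set h := v * vᴴ
  set V : Matrix (Fin 2) (Fin 2) ℂ := star (hh.isHermitian.eigenvectorUnitary : Matrix _ _ ℂ)
    with hV
  have hVV : V * Vᴴ = 1 := by
    rw [← star_eq_conjTranspose, hV, star_star]
    exact Unitary.coe_star_mul_self _
  have hdiag : V * h * Vᴴ = diagonal (fun i => (hh.isHermitian.eigenvalues i : ℂ)) := by
    have := hh.isHermitian.conjStarAlgAut_star_eigenvectorUnitary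
    rw [Unitary.conjStarAlgAut_star_apply] at this
    rw [← star_eq_conjTranspose, hV, star_star]
    exact this
  have hskew : (V * z * Vᴴ)ᴴ = -(V * z * Vᴴ) := by
    simp [conjTranspose_mul, hz, Matrix.mul_assoc]
  set y := V * z * Vᴴ with hy
  have hent : ∀ i j, star (y j i) = -y i j := fun i j => congrFun (congrFun hskew i) j
  have hre : ∀ i, y i i = Complex.I * ((y i i).im : ℝ) := by
    intro i
    have := congrArg Complex.re (hent i i)
    simp at this
    apply Complex.ext <;> simp
    linarith
  obtain ⟨μ, hμ, c, hc⟩ : ∃ μ : ℂ, μ * star μ = 1 ∧ ∃ c : ℝ, y 0 1 * star μ = Complex.I * c := by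
    by_cases h0 : y 0 1 = 0
    · exact ⟨1, by simp, 0, by simp [h0]⟩
    · refine ⟨star (Complex.I * ‖y 0 1‖ / y 0 1), ?_, ‖y 0 1‖, ?_⟩
      · rw [star_star, mul_comm]
        have := Complex.mul_conj (Complex.I * ‖y 0 1‖ / y 0 1)
        rw [Complex.normSq_eq_norm_sq] at this
        have hn : ‖y 0 1‖ ≠ 0 := norm_ne_zero_iff.2 h0
        simpa [hn] using this
      · rw [star_star]
        field_simp
  have hc' : μ * y 1 0 = Complex.I * c := by
    have h1 := congrArg star hc
    have h2 := hent 1 0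
    rw [star_mul', star_star, h2] at h1
    simp at h1
    rw [mul_comm, h1]
  have hnn := hh.eigenvalues_nonneg
  refine ⟨diagonal ![1, μ] * V, √(hh.isHermitian.eigenvalues 0), √(hh.isHermitian.eigenvalues 1), c,
    (y 0 0).im, (y 1 1).im, ?_, ?_, ?_⟩
  · rw [conjTranspose_mul, Matrix.mul_assoc, ← Matrix.mul_assoc V, hVV, Matrix.one_mul]
    ext i j
    fin_cases i <;> fin_cases j <;> simp [diagonal_conjTranspose, mul_diagonal]
    exact hμ
  · have : diagonal ![1, μ] * V * h * (diagonal ![1, μ] * V)ᴴ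
      = diagonal ![1, μ] * (V * h * Vᴴ) * (diagonal ![1, μ])ᴴ := by
      simp only [conjTranspose_mul, Matrix.mul_assoc]
    rw [this, hdiag]
    have e : ∀ i, ((√(hh.isHermitian.eigenvalues i) : ℝ) : ℂ) ^ 2 =
        (hh.isHermitian.eigenvalues i : ℂ) := fun i => by
      rw [← Complex.ofReal_pow, Real.sq_sqrt (hnn i)]
    have hμ' : ∀ x : ℂ, μ * x * star μ = x := fun x => by
      rw [mul_right_comm, hμ, one_mul]
    ext i j
    fin_cases i <;> fin_cases j <;> simp [diagonal_conjTranspose, mul_diagonal, e]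
    exact hμ' _
  · have : diagonal ![1, μ] * V * z * (diagonal ![1, μ] * V)ᴴ
      = diagonal ![1, μ] * y * (diagonal ![1, μ])ᴴ := by
      simp only [hy, conjTranspose_mul, Matrix.mul_assoc]
    have hμ' : ∀ x : ℂ, μ * x * star μ = x := fun x => by
      rw [mul_right_comm, hμ, one_mul]
    rw [this]
    ext i j
    fin_cases i <;> fin_cases j <;> simp [diagonal_conjTranspose, diagonal_mul, mul_diagonal]
    · exact hre 0
    · exact hc
    · exact hc'
    · exact (hμ' _).trans (hre 1)

/-- The `2 × n` matrix `[1 | 0]`. -/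
def padMatrix (n : ℕ) : Matrix (Fin 2) (Fin n) ℂ :=
  Matrix.of fun i j => if i.val = j.val then 1 else 0

open Matrix in
theorem padMatrix_mul_conjTranspose {n : ℕ} (hn : 2 ≤ n) :
    padMatrix n * (padMatrix n)ᴴ = 1 := by
  obtain ⟨k, rfl⟩ := Nat.exists_eq_add_of_le' hn
  ext i j
  fin_cases i <;> fin_cases j <;>
    simp [padMatrix, Matrix.mul_apply, Fin.sum_univ_succ, Fin.val_succ]

open Matrix in
theorem gram_mul_padMatrix {n : ℕ} (hn : 2 ≤ n) (M : Matrix (Fin 2) (Fin 2) ℂ) :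
    M * padMatrix n * (M * padMatrix n)ᴴ = M * Mᴴ := by
  rw [conjTranspose_mul, Matrix.mul_assoc, ← Matrix.mul_assoc (padMatrix n),
    padMatrix_mul_conjTranspose hn, Matrix.one_mul]

theorem mul_padMatrix_apply {n : ℕ} (M : Matrix (Fin 2) (Fin 2) ℂ) (i : Fin 2) (j : Fin n) :
    (M * padMatrix n) i j = if h : j.val < 2 then M i ⟨j.val, h⟩ else 0 := by
  rcases j with ⟨_ | _ | j, hj⟩ <;> simp [padMatrix, Matrix.mul_apply, Fin.sum_univ_two]

open MvPolynomial in
theorem exists_eval_eq_of_polynomial_family {n : ℕ}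
    (F : Matrix (Fin 2) (Fin n) ℂ → Matrix (Fin 2) (Fin 2) ℂ → ℝ)
    (hpoly : ∃ p : MvPolynomial ((Fin 2 × Fin n ⊕ Fin 2 × Fin 2) ⊕
        (Fin 2 × Fin n ⊕ Fin 2 × Fin 2)) ℝ,
      ∀ (v : Matrix (Fin 2) (Fin n) ℂ) (z : Matrix (Fin 2) (Fin 2) ℂ),
        z.conjTranspose = -z →
        F v z = MvPolynomial.eval
          (Sum.elim
            (fun s => (Sum.elim (fun q : Fin 2 × Fin n => v q.1 q.2)
              (fun q : Fin 2 × Fin 2 => z q.1 q.2) s).re)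
            fun s => (Sum.elim (fun q : Fin 2 × Fin n => v q.1 q.2)
              (fun q : Fin 2 × Fin 2 => z q.1 q.2) s).im) p)
    {σ : Type*} (M Z : (σ → ℝ) → Matrix (Fin 2) (Fin 2) ℂ)
    (hZ : ∀ x, (Z x).conjTranspose = -Z x)
    (hMre : ∀ i j, ∃ q : MvPolynomial σ ℝ, ∀ x, (M x i j).re = eval x q)
    (hMim : ∀ i j, ∃ q : MvPolynomial σ ℝ, ∀ x, (M x i j).im = eval x q)
    (hZre : ∀ i j, ∃ q : MvPolynomial σ ℝ, ∀ x, (Z x i j).re = eval x q)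
    (hZim : ∀ i j, ∃ q : MvPolynomial σ ℝ, ∀ x, (Z x i j).im = eval x q) :
    ∃ P : MvPolynomial σ ℝ, ∀ x, F (M x * padMatrix n) (Z x) = eval x P := by
  obtain ⟨p, hp⟩ := hpoly
  let y : (σ → ℝ) → Fin 2 × Fin n ⊕ Fin 2 × Fin 2 → ℂ := fun x =>
    Sum.elim (fun q => (M x * padMatrix n) q.1 q.2) (fun q => Z x q.1 q.2)
  have hy : ∀ k, ∃ q : MvPolynomial σ ℝ, ∀ x,
      Sum.elim (fun s => (y x s).re) (fun s => (y x s).im) k = eval (id x) q := by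
    intro k
    rcases k with (⟨i, j⟩ | ⟨i, j⟩) | (⟨i, j⟩ | ⟨i, j⟩)
    · simp only [y, Sum.elim_inl, mul_padMatrix_apply]
      split_ifs
      · exact hMre _ _
      · exact ⟨0, by simp⟩
    · exact hZre i j
    · simp only [y, Sum.elim_inl, Sum.elim_inr, mul_padMatrix_apply]
      split_ifs
      · exact hMim _ _
      · exact ⟨0, by simp⟩
    · exact hZim i j
  obtain ⟨P, hP⟩ := exists_eval_comp_eq
    (fun x => Sum.elim (fun s => (y x s).re) (fun s => (y x s).im)) id hy p
  exact ⟨P, fun x => (hp _ _ (hZ x)).trans (hP x)⟩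

open MvPolynomial in
theorem exists_eval_sq_of_even_three (φ : ℝ → ℝ → ℝ → ℝ → ℝ → ℝ)
    (hφ : ∃ P : MvPolynomial (Fin 5) ℝ, ∀ x, φ (x 0) (x 1) (x 2) (x 3) (x 4) = eval x P)
    (ha : ∀ a b c s t, φ (-a) b c s t = φ a b c s t)
    (hb : ∀ a b c s t, φ a (-b) c s t = φ a b c s t)
    (hc : ∀ a b c s t, φ a b (-c) s t = φ a b c s t) :
    ∃ g : MvPolynomial (Fin 5) ℝ, ∀ a b c s t,
      φ a b c s t = eval ![a ^ 2, b ^ 2, c ^ 2, s, t] g := by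
  obtain ⟨P, hP⟩ := hφ
  obtain ⟨P₀, hP₀⟩ := exists_eval_sq_of_even 0 P
  obtain ⟨P₁, hP₁⟩ := exists_eval_sq_of_even 1 P₀
  obtain ⟨P₂, hP₂⟩ := exists_eval_sq_of_even 2 P₁
  have u0 : ∀ a b c s t x : ℝ, Function.update ![a, b, c, s, t] 0 x = ![x, b, c, s, t] := by
    intro a b c s t x; ext i; fin_cases i <;> rfl
  have u1 : ∀ a b c s t x : ℝ, Function.update ![a, b, c, s, t] 1 x = ![a, x, c, s, t] := by
    intro a b c s t x; ext i; fin_cases i <;> rfl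
  have u2 : ∀ a b c s t x : ℝ, Function.update ![a, b, c, s, t] 2 x = ![a, b, x, s, t] := by
    intro a b c s t x; ext i; fin_cases i <;> rfl
  have e : ∀ a b c s t, φ a b c s t = eval ![a, b, c, s, t] P :=
    fun a b c s t => hP ![a, b, c, s, t]
  have e0 : ∀ a b c s t, φ a b c s t = eval ![a ^ 2, b, c, s, t] P₀ := by
    intro a b c s t
    have h := hP₀ ![a, b, c, s, t]
    rw [u0, u0] at h
    exact (e a b c s t).trans (h ((e (-a) b c s t).symm.trans ((ha a b c s t).trans
      (e a b c s t))))
  have e1 : ∀ a b c s t, φ a b c s t = eval ![a ^ 2, b ^ 2, c, s, t] P₁ := by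
    intro a b c s t
    have h := hP₁ ![a ^ 2, b, c, s, t]
    rw [u1, u1] at h
    exact (e0 a b c s t).trans (h ((e0 a (-b) c s t).symm.trans ((hb a b c s t).trans
      (e0 a b c s t))))
  refine ⟨P₂, fun a b c s t => ?_⟩
  have h := hP₂ ![a ^ 2, b ^ 2, c, s, t]
  rw [u2, u2] at h
  exact (e1 a b c s t).trans (h ((e1 a b (-c) s t).symm.trans ((hc a b c s t).trans
    (e1 a b c s t))))

/-- The family `i [[s, c], [c, t]]` of skew-Hermitian matrices. -/
def skewMatrix (s c t : ℝ) : Matrix (Fin 2) (Fin 2) ℂ :=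
  !![Complex.I * s, Complex.I * c; Complex.I * c, Complex.I * t]

/-- The family `[[a, 0], [c, b]]` of real lower triangular matrices. -/
def lowerMatrix (a c b : ℝ) : Matrix (Fin 2) (Fin 2) ℂ :=
  !![(a : ℂ), 0; (c : ℂ), (b : ℂ)]

theorem skewMatrix_conjTranspose (s c t : ℝ) :
    (skewMatrix s c t).conjTranspose = -skewMatrix s c t := by
  ext i j
  fin_cases i <;> fin_cases j <;> simp [skewMatrix]

open Matrix in
theorem lowerMatrix_gram (a c b : ℝ) : lowerMatrix a c b * (lowerMatrix a c b)ᴴ =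
    !![((a ^ 2 : ℝ) : ℂ), ((a * c : ℝ) : ℂ);
      ((a * c : ℝ) : ℂ), ((c ^ 2 + b ^ 2 : ℝ) : ℂ)] := by
  ext i j
  fin_cases i <;> fin_cases j <;>
    simp [lowerMatrix, Matrix.mul_apply, Fin.sum_univ_two] <;> ring

open MvPolynomial in
theorem exists_eval_lower_skew {n : ℕ}
    (F : Matrix (Fin 2) (Fin n) ℂ → Matrix (Fin 2) (Fin 2) ℂ → ℝ)
    (hpoly : ∃ p : MvPolynomial ((Fin 2 × Fin n ⊕ Fin 2 × Fin 2) ⊕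
        (Fin 2 × Fin n ⊕ Fin 2 × Fin 2)) ℝ,
      ∀ (v : Matrix (Fin 2) (Fin n) ℂ) (z : Matrix (Fin 2) (Fin 2) ℂ),
        z.conjTranspose = -z →
        F v z = MvPolynomial.eval
          (Sum.elim
            (fun s => (Sum.elim (fun q : Fin 2 × Fin n => v q.1 q.2)
              (fun q : Fin 2 × Fin 2 => z q.1 q.2) s).re)
            fun s => (Sum.elim (fun q : Fin 2 × Fin n => v q.1 q.2)
              (fun q : Fin 2 × Fin 2 => z q.1 q.2) s).im) p)
    {σ : Type*} (qa qc qb qs qk qt : MvPolynomial σ ℝ) :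
    ∃ P : MvPolynomial σ ℝ, ∀ x,
      F (lowerMatrix (eval x qa) (eval x qc) (eval x qb) * padMatrix n)
        (skewMatrix (eval x qs) (eval x qk) (eval x qt)) = eval x P := by
  refine exists_eval_eq_of_polynomial_family F hpoly
    (fun x => lowerMatrix (eval x qa) (eval x qc) (eval x qb))
    (fun x => skewMatrix (eval x qs) (eval x qk) (eval x qt))
    (fun x => skewMatrix_conjTranspose _ _ _) ?_ ?_ ?_ ?_ <;> intro i j
  · exact ⟨!![qa, 0; qc, qb] i j, fun x => by
      fin_cases i <;> fin_cases j <;> simp [lowerMatrix]⟩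
  · exact ⟨0, fun x => by fin_cases i <;> fin_cases j <;> simp [lowerMatrix]⟩
  · exact ⟨0, fun x => by fin_cases i <;> fin_cases j <;> simp [skewMatrix]⟩
  · exact ⟨!![qs, qk; qk, qt] i j, fun x => by
      fin_cases i <;> fin_cases j <;> simp [skewMatrix]⟩

open Matrix in
theorem rotation_gram (C S a b a' b' c' : ℝ) (h₁ : C ^ 2 * a ^ 2 + S ^ 2 * b ^ 2 = a' ^ 2)
    (h₂ : C * S * (b ^ 2 - a ^ 2) = a' * c')
    (h₃ : S ^ 2 * a ^ 2 + C ^ 2 * b ^ 2 = c' ^ 2 + b' ^ 2) :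
    !![(C : ℂ), (S : ℂ); -(S : ℂ), (C : ℂ)] * (lowerMatrix a 0 b * (lowerMatrix a 0 b)ᴴ) *
      !![(C : ℂ), (S : ℂ); -(S : ℂ), (C : ℂ)]ᴴ = lowerMatrix a' c' b' * (lowerMatrix a' c' b')ᴴ := by
  rw [lowerMatrix_gram, lowerMatrix_gram, ← h₁, ← h₂, ← h₃]
  ext i j
  fin_cases i <;> fin_cases j <;> simp [Matrix.mul_apply, Fin.sum_univ_two] <;> ring

open Matrix in
theorem rotation_skew (C S s c t s' t' : ℝ) (h₁ : C ^ 2 * s + 2 * C * S * c + S ^ 2 * t = s')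
    (h₂ : C * S * (t - s) + (C ^ 2 - S ^ 2) * c = 0)
    (h₃ : S ^ 2 * s - 2 * C * S * c + C ^ 2 * t = t') :
    !![(C : ℂ), (S : ℂ); -(S : ℂ), (C : ℂ)] * skewMatrix s c t *
      !![(C : ℂ), (S : ℂ); -(S : ℂ), (C : ℂ)]ᴴ = skewMatrix s' 0 t' := by
  rw [skewMatrix, skewMatrix, ← h₁, ← h₃, ← h₂]
  ext i j
  fin_cases i <;> fin_cases j <;> simp [Matrix.mul_apply, Fin.sum_univ_two] <;> ring

open Matrix in
theorem rotation_unitary (C S : ℝ) (h : C ^ 2 + S ^ 2 = 1) :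
    !![(C : ℂ), (S : ℂ); -(S : ℂ), (C : ℂ)] * !![(C : ℂ), (S : ℂ); -(S : ℂ), (C : ℂ)]ᴴ = 1 := by
  have h' : (C : ℂ) * C + S * S = 1 := by
    rw [← sq, ← sq]; exact_mod_cast h
  ext i j
  fin_cases i <;> fin_cases j <;> simp [Matrix.mul_apply, Fin.sum_univ_two, h']
  · ring
  · ring
  · rw [add_comm]; exact h'

/-- The five basic invariants at `(v, z)`, expressed through `h = v vᴴ` and `z`. -/
theorem invariants_eq_of_unitary_conj {n : Type*} [Fintype n]
    (k : Matrix (Fin 2) (Fin 2) ℂ) (hk : k * k.conjTranspose = 1)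
    (v : Matrix (Fin 2) n ℂ) (z h z' : Matrix (Fin 2) (Fin 2) ℂ)
    (hh : k * (v * v.conjTranspose) * k.conjTranspose = h) (hz : k * z * k.conjTranspose = z') :
    Matrix.trace z = Matrix.trace z' ∧ Matrix.trace (z ^ 2) = Matrix.trace (z' ^ 2) ∧
      Matrix.trace (v * v.conjTranspose) = Matrix.trace h ∧
      Matrix.trace ((v * v.conjTranspose) ^ 2) = Matrix.trace (h ^ 2) ∧
      Matrix.trace (v.conjTranspose * z * v) = Matrix.trace (z' * h) := by
  have hk' : k.conjTranspose * k = 1 := mul_eq_one_comm.1 hk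
  have tr : ∀ m : Matrix (Fin 2) (Fin 2) ℂ,
      Matrix.trace (k * m * k.conjTranspose) = Matrix.trace m := fun m => by
    rw [Matrix.trace_mul_cycle, hk', Matrix.one_mul]
  have mul : ∀ m m' : Matrix (Fin 2) (Fin 2) ℂ,
      k * m * k.conjTranspose * (k * m' * k.conjTranspose) = k * (m * m') * k.conjTranspose := by
    intro m m'
    calc _ = k * m * (k.conjTranspose * k) * m' * k.conjTranspose := by
          simp only [Matrix.mul_assoc]
      _ = _ := by rw [hk', Matrix.mul_one]; simp only [Matrix.mul_assoc]
  subst hh hz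
  simp only [sq, mul, tr, true_and]
  rw [Matrix.trace_mul_comm, ← Matrix.mul_assoc, Matrix.trace_mul_comm]

open MvPolynomial Matrix in
/-- Conjugating `[[s, c], [c, t]]` to diagonal form by a rotation relates the values of an
invariant function on the two families of normal forms. -/
theorem slices_agree {n : ℕ} (φ : Matrix (Fin 2) (Fin n) ℂ → Matrix (Fin 2) (Fin 2) ℂ → ℝ)
    (hn : 2 ≤ n)
    (hφ : ∀ (k : Matrix (Fin 2) (Fin 2) ℂ), k * kᴴ = 1 →
      ∀ (v w : Matrix (Fin 2) (Fin n) ℂ) (z z' : Matrix (Fin 2) (Fin 2) ℂ), zᴴ = -z →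
        k * (v * vᴴ) * kᴴ = w * wᴴ → k * z * kᴴ = z' → φ w z' = φ v z)
    (g₁ g₂ : MvPolynomial (Fin 5) ℝ)
    (h₁ : ∀ a b c s t : ℝ, φ (lowerMatrix a 0 b * padMatrix n) (skewMatrix s c t) =
      eval ![a ^ 2, b ^ 2, c ^ 2, s, t] g₁)
    (h₂ : ∀ a b c s t : ℝ, φ (lowerMatrix a c b * padMatrix n) (skewMatrix s 0 t) =
      eval ![a ^ 2, b ^ 2, c ^ 2, s, t] g₂)
    (p m d r e : ℝ) (hd : 0 < d) (hdp : d < p) (he : 0 < e) (hm : |m| < d * e) :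
    eval ![(p + d) / 2, (p - d) / 2, (e ^ 2 - (m / d) ^ 2) / 4, (r + m / d) / 2, (r - m / d) / 2]
        g₁ =
      eval ![(p + m / e) / 2, (p - m / e) / 2 - (d ^ 2 - (m / e) ^ 2) / (2 * (p + m / e)),
        (d ^ 2 - (m / e) ^ 2) / (2 * (p + m / e)), (r + e) / 2, (r - e) / 2] g₂ := by
  obtain ⟨q, rfl⟩ : ∃ q, m = d * e * q := ⟨m / (d * e), by field_simp⟩
  have hde : 0 < d * e := mul_pos hd he
  rw [abs_mul, abs_of_pos hde] at hm
  have hq : |q| < 1 := by nlinarith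
  obtain ⟨hq1, hq2⟩ := abs_lt.1 hq
  obtain ⟨C, S, hC, hS⟩ : ∃ C S : ℝ, C ^ 2 = (1 + q) / 2 ∧ S ^ 2 = (1 - q) / 2 :=
    ⟨√((1 + q) / 2), √((1 - q) / 2), Real.sq_sqrt (by linarith), Real.sq_sqrt (by linarith)⟩
  have m1 : d * e * q / d = e * q := by field_simp
  have m2 : d * e * q / e = d * q := by field_simp
  rw [m1, m2]
  have hpos : 0 < p + d * q := by nlinarith
  have hlow : 0 ≤ (p - d * q) / 2 - (d ^ 2 - (d * q) ^ 2) / (2 * (p + d * q)) := by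
    have : (p - d * q) / 2 - (d ^ 2 - (d * q) ^ 2) / (2 * (p + d * q))
      = (p ^ 2 - d ^ 2) / (2 * (p + d * q)) := by field_simp; ring
    rw [this]
    exact div_nonneg (by nlinarith) (by linarith)
  obtain ⟨a, ha⟩ : ∃ a : ℝ, a ^ 2 = (p + d) / 2 := ⟨_, Real.sq_sqrt (by linarith)⟩
  obtain ⟨b, hb⟩ : ∃ b : ℝ, b ^ 2 = (p - d) / 2 := ⟨_, Real.sq_sqrt (by linarith)⟩
  obtain ⟨a', ha'⟩ : ∃ a : ℝ, a ^ 2 = (p + d * q) / 2 := ⟨_, Real.sq_sqrt (by linarith)⟩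
  obtain ⟨b', hb'⟩ : ∃ b : ℝ,
      b ^ 2 = (p - d * q) / 2 - (d ^ 2 - (d * q) ^ 2) / (2 * (p + d * q)) :=
    ⟨_, Real.sq_sqrt hlow⟩
  have ha0 : a' ≠ 0 := by
    rintro rfl
    norm_num at ha'
    linarith
  have hCS : (C * S) ^ 2 = (1 - q ^ 2) / 4 := by rw [mul_pow, hC, hS]; ring
  have hc : (e * (C * S)) ^ 2 = (e ^ 2 - (e * q) ^ 2) / 4 := by rw [mul_pow, hCS]; ring
  have hc' : (-(d * (C * S)) / a') ^ 2 = (d ^ 2 - (d * q) ^ 2) / (2 * (p + d * q)) := by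
    rw [div_pow, neg_sq, mul_pow, hCS, ha']
    field_simp
    ring
  rw [← ha, ← hb, ← hc, ← ha', ← hb', ← hc', ← h₁, ← h₂]
  refine (hφ _ (rotation_unitary C S (by rw [hC, hS]; ring)) _ _ _ _
    (skewMatrix_conjTranspose _ _ _) ?_ ?_).symm
  · rw [gram_mul_padMatrix hn, gram_mul_padMatrix hn]
    refine rotation_gram _ _ _ _ _ _ _ ?_ ?_ ?_
    · rw [hC, hS, ha, hb, ha']; ring
    · rw [ha, hb, mul_div_cancel₀ _ ha0]; ring
    · rw [hC, hS, ha, hb, hb', hc']; ring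
  · refine rotation_skew _ _ _ _ _ _ _ ?_ ?_ ?_
    · rw [hC, hS]; linear_combination 2 * e * hCS
    · rw [hC, hS]; ring
    · rw [hC, hS]; linear_combination -2 * e * hCS

/-- **`U(2) × SU(n)`-invariants on `(ℂ² ⊗ ℂⁿ) ⊕ 𝔲(2)`, `n ≥ 2`.**
Every real-valued polynomial function on `M_{2×n}(ℂ) × 𝔲(2)` invariant under the action
`(k₁,k₂)·(v,z) = (k₁ v k₂*, k₁ z k₁*)` of `U(2) × SU(n)` belongs to the `ℝ`-subalgebra
generated by `F₁ = i tr(z)`, `F₂ = tr(z²)`, `F₃ = tr(vv*)`, `F₄ = tr((vv*)²)`,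
`F₅ = i tr(v* z v)`. -/
theorem U2_SUn_invariants (n : ℕ) (hn : 2 ≤ n)
    (F : Matrix (Fin 2) (Fin n) ℂ → Matrix (Fin 2) (Fin 2) ℂ → ℝ)
    (hpoly : ∃ p : MvPolynomial ((Fin 2 × Fin n ⊕ Fin 2 × Fin 2) ⊕
        (Fin 2 × Fin n ⊕ Fin 2 × Fin 2)) ℝ,
      ∀ (v : Matrix (Fin 2) (Fin n) ℂ) (z : Matrix (Fin 2) (Fin 2) ℂ),
        z.conjTranspose = -z →
        F v z = MvPolynomial.eval
          (Sum.elim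
            (fun s => (Sum.elim (fun q : Fin 2 × Fin n => v q.1 q.2)
              (fun q : Fin 2 × Fin 2 => z q.1 q.2) s).re)
            fun s => (Sum.elim (fun q : Fin 2 × Fin n => v q.1 q.2)
              (fun q : Fin 2 × Fin 2 => z q.1 q.2) s).im) p)
    (hinv : ∀ (k₁ : Matrix (Fin 2) (Fin 2) ℂ) (k₂ : Matrix (Fin n) (Fin n) ℂ),
      k₁ * k₁.conjTranspose = 1 → k₂ * k₂.conjTranspose = 1 → k₂.det = 1 →
      ∀ (v : Matrix (Fin 2) (Fin n) ℂ) (z : Matrix (Fin 2) (Fin 2) ℂ),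
        z.conjTranspose = -z →
        F (k₁ * v * k₂.conjTranspose) (k₁ * z * k₁.conjTranspose) = F v z) :
    ∃ Q : MvPolynomial (Fin 5) ℝ,
      ∀ (v : Matrix (Fin 2) (Fin n) ℂ) (z : Matrix (Fin 2) (Fin 2) ℂ),
        z.conjTranspose = -z →
        F v z = MvPolynomial.eval
          ![(Complex.I * Matrix.trace z).re, (Matrix.trace (z ^ 2)).re,
            (Matrix.trace (v * v.conjTranspose)).re,
            (Matrix.trace ((v * v.conjTranspose) ^ 2)).re,
            (Complex.I * Matrix.trace (v.conjTranspose * z * v)).re] Q := by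
  have : Nonempty (Fin n) := ⟨⟨0, by omega⟩⟩
  have hφ := eq_of_unitary_conj_gram F hinv
  have sign : !![(1 : ℂ), 0; 0, -1] * !![(1 : ℂ), 0; 0, -1].conjTranspose = 1 := by
    ext i j
    fin_cases i <;> fin_cases j <;> simp [Matrix.mul_apply, Fin.sum_univ_two]
  have gram_eq : ∀ a c b a' c' b' s k t : ℝ, a' ^ 2 = a ^ 2 → a' * c' = a * c →
      c' ^ 2 + b' ^ 2 = c ^ 2 + b ^ 2 →
      F (lowerMatrix a' c' b' * padMatrix n) (skewMatrix s k t) =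
        F (lowerMatrix a c b * padMatrix n) (skewMatrix s k t) := by
    intro a c b a' c' b' s k t h1 h2 h3
    refine hφ 1 (by simp) _ _ _ _ (skewMatrix_conjTranspose _ _ _) ?_ (by simp)
    rw [gram_mul_padMatrix hn, gram_mul_padMatrix hn, lowerMatrix_gram, lowerMatrix_gram,
      h1, h2, h3]
    simp
  have sign_eq : ∀ a c b s k t : ℝ,
      F (lowerMatrix a (-c) b * padMatrix n) (skewMatrix s (-k) t) =
        F (lowerMatrix a c b * padMatrix n) (skewMatrix s k t) := by
    intro a c b s k t
    refine hφ _ sign _ _ _ _ (skewMatrix_conjTranspose _ _ _) ?_ ?_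
    · rw [gram_mul_padMatrix hn, gram_mul_padMatrix hn, lowerMatrix_gram, lowerMatrix_gram]
      ext i j
      fin_cases i <;> fin_cases j <;> simp [Matrix.mul_apply, Fin.sum_univ_two]
    · ext i j
      fin_cases i <;> fin_cases j <;> simp [skewMatrix, Matrix.mul_apply, Fin.sum_univ_two]
  obtain ⟨g₁, hg₁⟩ := exists_eval_sq_of_even_three
    (fun a b c s t => F (lowerMatrix a 0 b * padMatrix n) (skewMatrix s c t))
    (by
      simpa using exists_eval_lower_skew F hpoly (MvPolynomial.X (0 : Fin 5)) 0
        (MvPolynomial.X 1) (MvPolynomial.X 3) (MvPolynomial.X 2) (MvPolynomial.X 4))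
    (fun a b c s t => gram_eq _ _ _ _ _ _ _ _ _ (by ring) (by ring) (by ring))
    (fun a b c s t => gram_eq _ _ _ _ _ _ _ _ _ (by ring) (by ring) (by ring))
    (fun a b c s t => by simpa using sign_eq a 0 b s c t)
  obtain ⟨g₂, hg₂⟩ := exists_eval_sq_of_even_three
    (fun a b c s t => F (lowerMatrix a c b * padMatrix n) (skewMatrix s 0 t))
    (by
      simpa using exists_eval_lower_skew F hpoly (MvPolynomial.X (0 : Fin 5))
        (MvPolynomial.X 2) (MvPolynomial.X 1) (MvPolynomial.X 3) 0 (MvPolynomial.X 4))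
    (fun a b c s t => by
      rw [← gram_eq a c b (-a) (-c) b s 0 t (by ring) (by ring) (by ring)]
      simpa using (sign_eq (-a) c b s 0 t).symm)
    (fun a b c s t => gram_eq _ _ _ _ _ _ _ _ _ (by ring) (by ring) (by ring))
    (fun a b c s t => by simpa using sign_eq a c b s 0 t)
  obtain ⟨Q, hQ⟩ := polynomial_descent g₁ g₂ (slices_agree F hn hφ g₁ g₂ hg₁ hg₂)
  obtain ⟨Q', hQ'⟩ := MvPolynomial.exists_eval_comp_eq
    (fun y : Fin 5 → ℝ => ![y 2, -2 * y 4 + y 2 * y 0, 2 * y 3 - y 2 ^ 2, -y 0,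
      -2 * y 1 - y 0 ^ 2]) id (fun i => by
        fin_cases i
        · exact ⟨MvPolynomial.X 2, by simp⟩
        · exact ⟨-MvPolynomial.C 2 * MvPolynomial.X 4 + MvPolynomial.X 2 * MvPolynomial.X 0,
            by simp⟩
        · exact ⟨MvPolynomial.C 2 * MvPolynomial.X 3 - MvPolynomial.X 2 ^ 2, by simp⟩
        · exact ⟨-MvPolynomial.X 0, by simp⟩
        · exact ⟨-MvPolynomial.C 2 * MvPolynomial.X 1 - MvPolynomial.X 0 ^ 2, by simp⟩) Q
  refine ⟨Q', fun v z hz => ?_⟩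
  obtain ⟨k, a, b, c, s, t, hk, hkh, hkz⟩ := Matrix.exists_unitary_conj_diagonal_and_skew
    v z hz
  have hlow : !![(a ^ 2 : ℂ), 0; 0, (b ^ 2 : ℂ)] =
      lowerMatrix a 0 b * (lowerMatrix a 0 b).conjTranspose := by
    rw [lowerMatrix_gram]; simp
  obtain ⟨e1, e2, e3, e4, e5⟩ := invariants_eq_of_unitary_conj k hk v z _ _ hkh hkz
  rw [← hφ k hk v (lowerMatrix a 0 b * padMatrix n) z (skewMatrix s c t) hz
    (by rw [gram_mul_padMatrix hn, hkh, hlow]) hkz, hg₁ a b c s t, hQ, e1, e2, e3, e4, e5]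
  refine Eq.trans ?_ (hQ' _)
  congr 2
  have cast : ∀ x : ℂ, ∀ y : ℝ, x = y → x.re = y := fun x y h => by rw [h, Complex.ofReal_re]
  have f1 : (Complex.I * Matrix.trace !![Complex.I * (s : ℂ), Complex.I * c;
      Complex.I * c, Complex.I * t]).re = -(s + t) := by
    refine cast _ _ ?_
    rw [Matrix.trace_fin_two]
    push_cast
    simp only [Matrix.of_apply, Matrix.cons_val]
    linear_combination (s + t : ℂ) * Complex.I_mul_I
  have f2 : (Matrix.trace (!![Complex.I * (s : ℂ), Complex.I * c;
      Complex.I * c, Complex.I * t] ^ 2)).re = -(s ^ 2 + t ^ 2 + 2 * c ^ 2) := by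
    refine cast _ _ ?_
    rw [Matrix.trace_fin_two, sq]
    push_cast
    simp only [Matrix.mul_apply, Fin.sum_univ_two, Matrix.of_apply, Matrix.cons_val]
    linear_combination (s ^ 2 + t ^ 2 + 2 * c ^ 2 : ℂ) * Complex.I_mul_I
  have f3 : (Matrix.trace !![(a ^ 2 : ℂ), 0; 0, (b ^ 2 : ℂ)]).re = a ^ 2 + b ^ 2 := by
    refine cast _ _ ?_
    rw [Matrix.trace_fin_two]
    simp
  have f4 : (Matrix.trace (!![(a ^ 2 : ℂ), 0; 0, (b ^ 2 : ℂ)] ^ 2)).re = a ^ 4 + b ^ 4 := by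
    refine cast _ _ ?_
    rw [Matrix.trace_fin_two, sq]
    push_cast
    simp only [Matrix.mul_apply, Fin.sum_univ_two, Matrix.of_apply, Matrix.cons_val]
    ring
  have f5 : (Complex.I * Matrix.trace (!![Complex.I * (s : ℂ), Complex.I * c;
      Complex.I * c, Complex.I * t] * !![(a ^ 2 : ℂ), 0; 0, (b ^ 2 : ℂ)])).re =
      -(a ^ 2 * s + b ^ 2 * t) := by
    refine cast _ _ ?_
    rw [Matrix.trace_fin_two]
    push_cast
    simp only [Matrix.mul_apply, Fin.sum_univ_two, Matrix.of_apply, Matrix.cons_val]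
    linear_combination (a ^ 2 * s + b ^ 2 * t : ℂ) * Complex.I_mul_I
  rw [f1, f2, f3, f4, f5]
  ext i
  fin_cases i <;> simp <;> ring
end

section
/- Let n ≥ 2. The five real-valued polynomial functions on M_{2×n}(ℂ) × 𝔲(2) given by F₁(v,z) = i tr(z), F₂(v,z) = tr(z²), F₃(v,z) = tr(v v*), F₄(v,z) = tr((v v*)²), F₅(v,z) = i tr(v* z v) are algebraically independent over ℝ. -/
/-- The space `M_{2×n}(ℂ) × 𝔲(2)` of pairs of a `2×n` complex matrix and a skew-Hermitian
`2×2` matrix. -/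
abbrev MatSkewHermPair (n : ℕ) :=
  {q : Matrix (Fin 2) (Fin n) ℂ × Matrix (Fin 2) (Fin 2) ℂ // q.2.conjTranspose = -q.2}

/-- The pair of the rectangular diagonal matrix with entries `a, b` and the skew-Hermitian matrix
`[[i x, w], [-w, i y]]`, with `a, b, x, y, w` real. -/
noncomputable def MatSkewHermPair.slice (m : ℕ) (a b x y w : ℝ) : MatSkewHermPair (m + 2) :=
  ⟨(Matrix.of ![fun j => if j = 0 then (a : ℂ) else 0, fun j => if j = 1 then (b : ℂ) else 0],
    !![Complex.I * x, (w : ℂ); -(w : ℂ), Complex.I * y]), by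
    ext i j
    fin_cases i <;> fin_cases j <;> simp [Matrix.conjTranspose_apply]⟩

lemma MatSkewHermPair.slice_mul_conjTranspose (m : ℕ) (a b x y w : ℝ) :
    (slice m a b x y w).1.1 * (slice m a b x y w).1.1.conjTranspose
      = !![(a : ℂ) ^ 2, 0; 0, (b : ℂ) ^ 2] := by
  ext i j
  fin_cases i <;> fin_cases j <;>
    simp [slice, Matrix.mul_apply, Matrix.conjTranspose_apply, sq, apply_ite]

/-- Every point of an explicit box in `ℝ⁵` is a value of the five invariants on the slice. -/
lemma MatSkewHermPair.exists_slice_parameters {c₁ c₂ c₃ c₄ c₅ : ℝ}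
    (h₁ : c₁ ∈ Set.Icc (-1 : ℝ) 1) (h₂ : c₂ ∈ Set.Icc (-1000 : ℝ) (-100))
    (h₃ : c₃ ∈ Set.Icc (4 : ℝ) (41 / 10)) (h₄ : c₄ ∈ Set.Icc (10 : ℝ) 11)
    (h₅ : c₅ ∈ Set.Icc (-1 : ℝ) 1) :
    ∃ a b x y w : ℝ, -(x + y) = c₁ ∧ -(x ^ 2 + y ^ 2 + 2 * w ^ 2) = c₂ ∧ a ^ 2 + b ^ 2 = c₃ ∧
      a ^ 4 + b ^ 4 = c₄ ∧ -(x * a ^ 2 + y * b ^ 2) = c₅ := by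
  obtain ⟨h₁, h₁'⟩ := h₁
  obtain ⟨h₂, h₂'⟩ := h₂
  obtain ⟨h₃, h₃'⟩ := h₃
  obtain ⟨h₄, h₄'⟩ := h₄
  obtain ⟨h₅, h₅'⟩ := h₅
  obtain ⟨u, hu, hu₁, hu₃⟩ : ∃ u : ℝ, u ^ 2 = 2 * c₄ - c₃ ^ 2 ∧ 1 ≤ u ∧ u ≤ 3 := by
    refine ⟨√(2 * c₄ - c₃ ^ 2), Real.sq_sqrt (by nlinarith), ?_, ?_⟩
    · exact Real.one_le_sqrt.2 (by nlinarith)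
    · exact Real.sqrt_le_iff.2 ⟨by norm_num, by nlinarith⟩
  obtain ⟨d, hd, hdl, hdu⟩ : ∃ d : ℝ, d * u = c₁ * c₃ - 2 * c₅ ∧ -7 ≤ d ∧ d ≤ 7 := by
    refine ⟨(c₁ * c₃ - 2 * c₅) / u, div_mul_cancel₀ _ (by positivity), ?_, ?_⟩
    · rw [le_div_iff₀ (by positivity)]; nlinarith
    · rw [div_le_iff₀ (by positivity)]; nlinarith
  have hA := Real.sq_sqrt (show 0 ≤ (c₃ + u) / 2 by linarith)
  have hB := Real.sq_sqrt (show 0 ≤ (c₃ - u) / 2 by linarith)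
  have hw := Real.sq_sqrt (show 0 ≤ (-c₂ - (c₁ ^ 2 + d ^ 2) / 2) / 2 by nlinarith)
  refine ⟨√((c₃ + u) / 2), √((c₃ - u) / 2), (-c₁ + d) / 2, (-c₁ - d) / 2,
    √((-c₂ - (c₁ ^ 2 + d ^ 2) / 2) / 2), by ring, ?_, ?_, ?_, ?_⟩
  · rw [hw]; ring
  · rw [hA, hB]; ring
  · rw [show ∀ r : ℝ, r ^ 4 = (r ^ 2) ^ 2 from fun r => by ring,
      show ∀ r : ℝ, r ^ 4 = (r ^ 2) ^ 2 from fun r => by ring, hA, hB]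
    linear_combination hu / 2
  · rw [hA, hB]; linear_combination -hd / 2

/-- The five real-valued polynomial functions `i tr(z)`, `tr(z²)`, `tr(vv*)`, `tr((vv*)²)`,
`i tr(v* z v)` on `M_{2×n}(ℂ) × 𝔲(2)` (`n ≥ 2`) are algebraically independent over `ℝ`. -/
theorem U2_SUn_invariants_algebraicIndependent (n : ℕ) (hn : 2 ≤ n) :
    AlgebraicIndependent ℝ
      (![fun p : MatSkewHermPair n => (Complex.I * Matrix.trace p.1.2).re,
         fun p : MatSkewHermPair n => (Matrix.trace (p.1.2 ^ 2)).re,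
         fun p : MatSkewHermPair n => (Matrix.trace (p.1.1 * p.1.1.conjTranspose)).re,
         fun p : MatSkewHermPair n => (Matrix.trace ((p.1.1 * p.1.1.conjTranspose) ^ 2)).re,
         fun p : MatSkewHermPair n =>
           (Complex.I * Matrix.trace (p.1.1.conjTranspose * p.1.2 * p.1.1)).re] :
        Fin 5 → (MatSkewHermPair n → ℝ)) := by
  obtain ⟨m, rfl⟩ := Nat.exists_eq_add_of_le' hn
  rw [algebraicIndependent_iff]
  intro Q hQ
  refine MvPolynomial.funext_set ![Set.Icc (-1) 1, Set.Icc (-1000) (-100),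
    Set.Icc 4 (41 / 10), Set.Icc 10 11, Set.Icc (-1) 1] ?_ ?_
  · intro i
    fin_cases i <;> exact Set.Icc_infinite (by norm_num)
  intro c hc
  rw [Set.mem_univ_pi] at hc
  obtain ⟨a, b, x, y, w, e₁, e₂, e₃, e₄, e₅⟩ :=
    MatSkewHermPair.exists_slice_parameters (hc 0) (hc 1) (hc 2) (hc 3) (hc 4)
  have key := congrArg (Pi.evalAlgHom ℝ (fun _ : MatSkewHermPair (m + 2) => ℝ)
    (MatSkewHermPair.slice m a b x y w)) hQ
  rw [MvPolynomial.comp_aeval_apply, map_zero] at key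
  rw [map_zero, ← key, MvPolynomial.aeval_def, MvPolynomial.eval, MvPolynomial.coe_eval₂Hom]
  congr 1
  funext i
  fin_cases i
  · simp [MatSkewHermPair.slice, Matrix.trace_fin_two, ← e₁]
  · simp [MatSkewHermPair.slice, Matrix.trace_fin_two, pow_two, ← e₂]
    ring
  · simp [MatSkewHermPair.slice_mul_conjTranspose, Matrix.trace_fin_two, ← e₃, ← Complex.ofReal_pow]
  · simp [MatSkewHermPair.slice_mul_conjTranspose, Matrix.trace_fin_two, pow_two, ← e₄]
    ring
  · have cycle := Matrix.trace_mul_cycle (MatSkewHermPair.slice m a b x y w).1.1.conjTranspose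
      (MatSkewHermPair.slice m a b x y w).1.2 (MatSkewHermPair.slice m a b x y w).1.1
    rw [MatSkewHermPair.slice_mul_conjTranspose] at cycle
    simp [cycle]
    simp [MatSkewHermPair.slice, Matrix.trace_fin_two, ← e₅, ← Complex.ofReal_pow]
    ring
end
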